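/- Let (A(l))_{l≥0} be a sequence of n×n row-stochastic matrices, let L be a positive integer and ρ ∈ (0,1] be such that every product of L consecutive matrices from the sequence satisfies λ(A(s+L−1)·…·A(s+1)·A(s)) ≤ 1 − ρ for all s ≥ 0. Then for all k ≤ t, δ(A(t)·A(t−1)·…·A(k)) ≤ (1 − ρ)^{⌊(t−k+1)/L⌋}. -/

import Mathlib

/-- `δ(X)`: the largest variation within any column of `X`. -/
noncomputable def delta {n : ℕ} (X : Matrix (Fin n) (Fin n) ℝ) : ℝ :=
  ⨆ j : Fin n, ⨆ i₁ : Fin n, ⨆ i₂ : Fin n, |X i₁ j - X i₂ j|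

/-- `λ(X) := 1 - min_{i₁,i₂} Σ_j min(X_{i₁,j}, X_{i₂,j})`. -/
noncomputable def lam {n : ℕ} (X : Matrix (Fin n) (Fin n) ℝ) : ℝ :=
  1 - ⨅ i₁ : Fin n, ⨅ i₂ : Fin n, ∑ j : Fin n, min (X i₁ j) (X i₂ j)

/-- A matrix is row-stochastic if all entries are nonnegative and each row sums to 1. -/
def IsRowStochastic {n : ℕ} (X : Matrix (Fin n) (Fin n) ℝ) : Prop :=
  (∀ i j, 0 ≤ X i j) ∧ ∀ i, ∑ j, X i j = 1

/-- The descending product `A(t)·A(t−1)·…·A(k)`. -/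
def descProd {n : ℕ} (A : ℕ → Matrix (Fin n) (Fin n) ℝ) (k t : ℕ) :
    Matrix (Fin n) (Fin n) ℝ :=
  (List.ofFn (fun i : Fin (t + 1 - k) => A (t - (i : ℕ)))).prod

theorem abs_sub_le_delta {n : ℕ} (X : Matrix (Fin n) (Fin n) ℝ) (i₁ i₂ j : Fin n) :
    |X i₁ j - X i₂ j| ≤ delta X :=
  (le_ciSup (f := fun i₂ => |X i₁ j - X i₂ j|) (Set.finite_range _).bddAbove i₂).trans <|
    (le_ciSup (f := fun i₁ => ⨆ i₂, |X i₁ j - X i₂ j|) (Set.finite_range _).bddAbove i₁).trans <|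
      le_ciSup (f := fun j => ⨆ i₁, ⨆ i₂, |X i₁ j - X i₂ j|) (Set.finite_range _).bddAbove j

theorem delta_le {n : ℕ} {X : Matrix (Fin n) (Fin n) ℝ} {c : ℝ} (hc : 0 ≤ c)
    (h : ∀ i₁ i₂ j, |X i₁ j - X i₂ j| ≤ c) : delta X ≤ c :=
  Real.iSup_le (fun j => Real.iSup_le (fun i₁ => Real.iSup_le (fun i₂ => h i₁ i₂ j) hc) hc) hc

theorem delta_nonneg {n : ℕ} (X : Matrix (Fin n) (Fin n) ℝ) : 0 ≤ delta X :=
  Real.iSup_nonneg fun _ => Real.iSup_nonneg fun _ => Real.iSup_nonneg fun _ => abs_nonneg _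

theorem one_sub_sum_min_le_lam {n : ℕ} (X : Matrix (Fin n) (Fin n) ℝ) (i₁ i₂ : Fin n) :
    1 - ∑ j, min (X i₁ j) (X i₂ j) ≤ lam X :=
  sub_le_sub_left ((ciInf_le (f := fun i₁ => ⨅ i₂, ∑ j, min (X i₁ j) (X i₂ j))
    (Set.finite_range _).bddBelow i₁).trans
      (ciInf_le (f := fun i₂ => ∑ j, min (X i₁ j) (X i₂ j)) (Set.finite_range _).bddBelow i₂)) 1

namespace IsRowStochastic

variable {n : ℕ} {P Q : Matrix (Fin n) (Fin n) ℝ}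

theorem le_one (hP : IsRowStochastic P) (i j : Fin n) : P i j ≤ 1 :=
  hP.2 i ▸ Finset.single_le_sum (fun l _ => hP.1 i l) (Finset.mem_univ j)

theorem one : IsRowStochastic (1 : Matrix (Fin n) (Fin n) ℝ) := by
  refine ⟨fun i j => ?_, fun i => by simp [Matrix.one_apply]⟩
  rw [Matrix.one_apply]
  split_ifs <;> norm_num

theorem mul (hP : IsRowStochastic P) (hQ : IsRowStochastic Q) : IsRowStochastic (P * Q) := by
  simp only [IsRowStochastic, Matrix.mul_apply]
  refine ⟨fun i j => Finset.sum_nonneg fun l _ => mul_nonneg (hP.1 i l) (hQ.1 l j), fun i => ?_⟩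
  rw [Finset.sum_comm]
  simp_rw [← Finset.mul_sum, hQ.2, mul_one, hP.2]

theorem delta_le_one (hP : IsRowStochastic P) : delta P ≤ 1 :=
  delta_le zero_le_one fun i₁ i₂ j => abs_sub_le_iff.2
    ⟨by linarith [hP.le_one i₁ j, hP.1 i₂ j], by linarith [hP.le_one i₂ j, hP.1 i₁ j]⟩

theorem mul_apply_sub_mul_apply_le (hP : IsRowStochastic P) (X : Matrix (Fin n) (Fin n) ℝ)
    (i₁ i₂ j : Fin n) : (P * X) i₁ j - (P * X) i₂ j ≤ lam P * delta X := by
  have : Nonempty (Fin n) := ⟨i₁⟩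
  obtain ⟨b, hb⟩ := Finite.exists_min fun l => X l j
  set m : Fin n → ℝ := fun l => min (P i₁ l) (P i₂ l)
  have hupper : ∑ l, (P i₁ l - m l) * X l j ≤ ∑ l, (P i₁ l - m l) * (X b j + delta X) :=
    Finset.sum_le_sum fun l _ => mul_le_mul_of_nonneg_left
      (by linarith [(abs_le.1 (abs_sub_le_delta X l b j)).2]) (sub_nonneg.2 (min_le_left _ _))
  have hlower : ∑ l, (P i₂ l - m l) * X b j ≤ ∑ l, (P i₂ l - m l) * X l j :=
    Finset.sum_le_sum fun l _ => mul_le_mul_of_nonneg_left (hb l) (sub_nonneg.2 (min_le_right _ _))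
  rw [← Finset.sum_mul, Finset.sum_sub_distrib, hP.2] at hupper hlower
  have hdiff : (P * X) i₁ j - (P * X) i₂ j =
      ∑ l, (P i₁ l - m l) * X l j - ∑ l, (P i₂ l - m l) * X l j := by
    simp only [Matrix.mul_apply, ← Finset.sum_sub_distrib]
    exact Finset.sum_congr rfl fun l _ => by ring
  have hlam := mul_le_mul_of_nonneg_right (one_sub_sum_min_le_lam P i₁ i₂) (delta_nonneg X)
  change (1 - ∑ l, m l) * delta X ≤ _ at hlam
  linarith

theorem delta_mul_le {c : ℝ} (hP : IsRowStochastic P) (hc : 0 ≤ c) (hPc : lam P ≤ c)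
    (X : Matrix (Fin n) (Fin n) ℝ) : delta (P * X) ≤ c * delta X := by
  have h := mul_le_mul_of_nonneg_right hPc (delta_nonneg X)
  exact delta_le (mul_nonneg hc (delta_nonneg X)) fun i₁ i₂ j => abs_sub_le_iff.2
    ⟨(hP.mul_apply_sub_mul_apply_le X i₁ i₂ j).trans h,
      (hP.mul_apply_sub_mul_apply_le X i₂ i₁ j).trans h⟩

end IsRowStochastic

/-- The product `A(s+m−1)·…·A(s+1)·A(s)` of `m` consecutive matrices. -/
def windowProd {n : ℕ} (A : ℕ → Matrix (Fin n) (Fin n) ℝ) (s : ℕ) :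
    ℕ → Matrix (Fin n) (Fin n) ℝ
  | 0 => 1
  | m + 1 => A (s + m) * windowProd A s m

section windowProd

variable {n : ℕ} (A : ℕ → Matrix (Fin n) (Fin n) ℝ)

theorem windowProd_add (s a b : ℕ) :
    windowProd A s (a + b) = windowProd A (s + a) b * windowProd A s a := by
  induction b with
  | zero => simp [windowProd]
  | succ b ih => rw [← add_assoc, windowProd, ih, windowProd, mul_assoc, add_assoc]

theorem prod_ofFn_eq_windowProd (s m : ℕ) :
    (List.ofFn fun i : Fin m => A (s + m - 1 - i)).prod = windowProd A s m := by
  induction m with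
  | zero => simp [windowProd]
  | succ m ih =>
    rw [List.ofFn_succ, List.prod_cons, windowProd, ← ih]
    congr 4
    funext i
    congr 1
    simp only [Fin.val_succ]
    omega

theorem descProd_eq_windowProd {k t m : ℕ} (h : t + 1 = k + m) :
    descProd A k t = windowProd A k m := by
  obtain rfl : m = t + 1 - k := by omega
  rw [← prod_ofFn_eq_windowProd, ← h]
  rfl

variable {A}

theorem IsRowStochastic.windowProd (hA : ∀ l, IsRowStochastic (A l)) (s m : ℕ) :
    IsRowStochastic (windowProd A s m) := by
  induction m with
  | zero => exact .one
  | succ m ih => exact (hA _).mul ih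

theorem delta_windowProd_le (hA : ∀ l, IsRowStochastic (A l)) {L : ℕ} {c : ℝ} (hc : 0 ≤ c)
    (hlam : ∀ s, lam (windowProd A s L) ≤ c) (s r q : ℕ) :
    delta (windowProd A s (r + L * q)) ≤ c ^ q := by
  induction q with
  | zero => simpa using (IsRowStochastic.windowProd hA s r).delta_le_one
  | succ q ih =>
    rw [mul_add_one, ← add_assoc, windowProd_add, pow_succ']
    exact ((IsRowStochastic.windowProd hA _ L).delta_mul_le hc (hlam _) _).trans
      (mul_le_mul_of_nonneg_left ih hc)

end windowProd

theorem stmt9 {n : ℕ} (A : ℕ → Matrix (Fin n) (Fin n) ℝ)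
    (hA : ∀ l, IsRowStochastic (A l)) (L : ℕ) (hL : 0 < L)
    (ρ : ℝ) (hρ0 : 0 < ρ) (hρ1 : ρ ≤ 1)
    (hlam : ∀ s, lam (descProd A s (s + L - 1)) ≤ 1 - ρ) :
    ∀ k t, k ≤ t → delta (descProd A k t) ≤ (1 - ρ) ^ ((t - k + 1) / L) := by
  intro k t hkt
  have hwindow : ∀ s, lam (windowProd A s L) ≤ 1 - ρ := fun s =>
    descProd_eq_windowProd A (show s + L - 1 + 1 = s + L by omega) ▸ hlam s
  rw [descProd_eq_windowProd A (show t + 1 = k + (t - k + 1) by omega)]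
  have h := delta_windowProd_le hA (sub_nonneg.2 hρ1) hwindow k ((t - k + 1) % L)
    ((t - k + 1) / L)
  rwa [Nat.mod_add_div] at h
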